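/- Let 𝔞 ⊆ 𝔤 be an abelian Lie subalgebra and let (e_1, …, e_N) be a Q-orthonormal basis of 𝔤 (N = dim 𝔤) such that 𝔞 = span(e_1, …, e_{q+1}) for some 0 ≤ q ≤ N−1. For each n ∈ ℕ let (e_1^{(n)}, …, e_N^{(n)}) be a Q-orthonormal basis of 𝔤 with e_i^{(n)} → e_i as n → ∞ for every 1 ≤ i ≤ N. Then there exist n̄ ∈ ℕ and C > 0 such that for all n ≥ n̄: Σ_{1 ≤ i, j ≤ q+1} Q(⁅e_1^{(n)}, e_i^{(n)}⁆, e_j^{(n)})² ≤ C · Σ_{i ≤ q+1 < k ≤ N} Q(⁅e_1^{(n)}, e_i^{(n)}⁆, e_k^{(n)})². -/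

import Mathlib

open scoped RealInnerProductSpace
open Filter

variable {𝔤 : Type*} [NormedAddCommGroup 𝔤] [InnerProductSpace ℝ 𝔤] [FiniteDimensional ℝ 𝔤]

section Matrices

variable {ι : Type*} [Fintype ι] [DecidableEq ι]

theorem Matrix.eq_zero_of_isIdempotentElem_of_trace_eq_zero {K : Type*} [Field K] [CharZero K]
    {E : Matrix ι ι K} (hE : IsIdempotentElem E) (h : E.trace = 0) : E = 0 := by
  have h1 : IsIdempotentElem (Matrix.toLin' E) := by
    rw [IsIdempotentElem, Module.End.mul_eq_comp, ← Matrix.toLin'_mul, hE]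
  have h2 := (LinearMap.IsIdempotentElem.trace_eq_zero_iff h1).mp
    (by rw [Matrix.trace_toLin'_eq, h])
  simpa using h2

theorem Matrix.isNilpotent_of_trace_pow_eq_zero {K : Type*} [Field K] [CharZero K]
    (T : Matrix ι ι K) (h : ∀ k : ℕ, (T ^ (k + 1)).trace = 0) : IsNilpotent T := by
  obtain ⟨g, hg, hdvd⟩ := Polynomial.exists_eq_pow_rootMultiplicity_mul_and_not_dvd T.charpoly
    T.charpoly_monic.ne_zero 0
  set a := T.charpoly.rootMultiplicity 0
  rw [map_zero, sub_zero] at hg hdvd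
  have hcop : IsCoprime (Polynomial.X ^ (a + 1)) g :=
    ((Polynomial.irreducible_X.coprime_iff_not_dvd).mpr hdvd).pow_left
  obtain ⟨u, v, huv⟩ := hcop
  have hzero : T ^ a * Polynomial.aeval T g = 0 := by
    have := T.aeval_self_charpoly
    rw [hg] at this
    simpa using this
  have hXg : Polynomial.aeval T (Polynomial.X ^ (a + 1) * g) = 0 := by
    rw [pow_succ', mul_assoc]
    simp [hzero]
  have htr : ∀ p : Polynomial K, (Polynomial.aeval T (p * Polynomial.X)).trace = 0 := by
    intro p
    induction p using Polynomial.induction_on' with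
    | add p q hp hq => rw [add_mul, map_add, Matrix.trace_add, hp, hq, add_zero]
    | monomial n c => simp [Polynomial.aeval_monomial, ← Algebra.smul_def, h]
  have hE : Polynomial.aeval T (u * Polynomial.X ^ (a + 1)) = 0 := by
    apply Matrix.eq_zero_of_isIdempotentElem_of_trace_eq_zero
    · have : u * Polynomial.X ^ (a + 1) * (u * Polynomial.X ^ (a + 1)) =
          u * Polynomial.X ^ (a + 1) - u * v * (Polynomial.X ^ (a + 1) * g) := by
        linear_combination (u * Polynomial.X ^ (a + 1)) * huv
      rw [IsIdempotentElem, ← map_mul, this, map_sub, map_mul _ (u * v), hXg, mul_zero, sub_zero]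
    · rw [pow_succ, ← mul_assoc]
      exact htr _
  refine ⟨a, ?_⟩
  have h1 : Polynomial.aeval T (v * g) = 1 := by
    have := congrArg (Polynomial.aeval T) huv
    rwa [map_add, hE, zero_add, map_one] at this
  calc T ^ a = T ^ a * Polynomial.aeval T (g * v) := by rw [mul_comm g, h1, mul_one]
    _ = 0 := by rw [map_mul, ← mul_assoc, hzero, zero_mul]

open scoped ComplexOrder in
theorem Matrix.IsHermitian.eq_zero_of_isNilpotent {H : Matrix ι ι ℂ} (hH : H.IsHermitian)
    (hn : IsNilpotent H) : H = 0 := by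
  obtain ⟨n, hn⟩ := hn
  have key : ∀ k : ℕ, H ^ 2 ^ k = 0 → H = 0 := by
    intro k
    induction k with
    | zero => simp
    | succ k ih =>
      intro h
      apply ih
      rw [← Matrix.conjTranspose_mul_self_eq_zero, (hH.pow _).eq, ← pow_add, ← two_mul,
        ← pow_succ', h]
  exact key n (pow_eq_zero_of_le Nat.lt_two_pow_self.le hn)

open scoped ComplexOrder in
theorem Matrix.eq_zero_of_isNilpotent_of_commute_conjTranspose {T : Matrix ι ι ℂ}
    (hn : IsNilpotent T) (hT : Commute T.conjTranspose T) : T = 0 := by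
  rw [← Matrix.conjTranspose_mul_self_eq_zero]
  exact (Matrix.isHermitian_conjTranspose_mul_self T).eq_zero_of_isNilpotent
    (hT.isNilpotent_mul_left hn)

/-- If `[D n, T n] + i T n → 0` and `T n → T`, then `T` has vanishing power traces, even when `D n`
is unbounded. -/
theorem Matrix.isNilpotent_of_tendsto_commutator {D T R : ℕ → Matrix ι ι ℂ} {T₀ : Matrix ι ι ℂ}
    (hDT : ∀ n, D n * T n - T n * D n = -Complex.I • T n + R n)
    (hR : Tendsto R atTop (nhds 0)) (hT : Tendsto T atTop (nhds T₀)) : IsNilpotent T₀ := by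
  apply Matrix.isNilpotent_of_trace_pow_eq_zero
  intro k
  have h1 : ∀ n, (T n ^ (k + 1)).trace = -Complex.I * (T n ^ k * R n).trace := by
    intro n
    have h2 : (T n ^ k * (D n * T n - T n * D n)).trace = 0 := by
      rw [mul_sub, Matrix.trace_sub, ← mul_assoc, ← mul_assoc, Matrix.trace_mul_comm _ (T n),
        ← mul_assoc, ← pow_succ', ← pow_succ, sub_self]
    rw [hDT, mul_add, Matrix.trace_add, mul_smul_comm, Matrix.trace_smul, ← pow_succ,
      smul_eq_mul] at h2
    linear_combination Complex.I * h2 + (T n ^ (k + 1)).trace * Complex.I_mul_I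
  have hl : Tendsto (fun n => (T n ^ (k + 1)).trace) atTop (nhds (T₀ ^ (k + 1)).trace) :=
    ((by fun_prop : Continuous fun A : Matrix ι ι ℂ => (A ^ (k + 1)).trace).tendsto T₀).comp hT
  have hr : Tendsto (fun n => -Complex.I * (T n ^ k * R n).trace) atTop (nhds 0) := by
    have := ((by fun_prop : Continuous fun A : Matrix ι ι ℂ × Matrix ι ι ℂ =>
      -Complex.I * (A.1 ^ k * A.2).trace).tendsto (T₀, 0)).comp (hT.prodMk_nhds hR)
    simpa [Function.comp_def] using this
  simp_rw [h1] at hl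
  exact tendsto_nhds_unique hl hr

end Matrices

section Skew

/-- A nonzero skew operator attains its norm on a plane on which it acts as a scaled rotation. -/
theorem exists_rotation_plane_of_skew (S : 𝔤 →ₗ[ℝ] 𝔤) (hS : ∀ x y, ⟪S x, y⟫ + ⟪x, S y⟫ = 0)
    (h0 : S ≠ 0) :
    ∃ (l : ℝ) (y z : 𝔤), 0 < l ∧ ‖y‖ = 1 ∧ ‖z‖ = 1 ∧ S y = l • z ∧ S z = -(l • y) ∧
      ∀ v, ‖S v‖ ≤ l * ‖v‖ := by
  obtain ⟨w, hw⟩ : ∃ w, S w ≠ 0 := by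
    by_contra! h
    exact h0 (LinearMap.ext h)
  have hw0 : w ≠ 0 := fun h => hw (by simp [h])
  have hcont : Continuous S := S.continuous_of_finiteDimensional
  obtain ⟨y, hy, hmax⟩ := (isCompact_sphere (0 : 𝔤) 1).exists_isMaxOn
    ⟨‖w‖⁻¹ • w, by simp [norm_smul, hw0]⟩ hcont.norm.continuousOn
  have hy1 : ‖y‖ = 1 := by simpa using hy
  have hbound : ∀ v, ‖S v‖ ≤ ‖S y‖ * ‖v‖ := by
    intro v
    by_cases hv : v = 0
    · simp [hv]
    have h1 : ‖S (‖v‖⁻¹ • v)‖ ≤ ‖S y‖ := hmax (show ‖v‖⁻¹ • v ∈ Metric.sphere (0 : 𝔤) 1 by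
      simp [norm_smul, hv])
    rw [map_smul, norm_smul, norm_inv, norm_norm, inv_mul_le_iff₀ (norm_pos_iff.mpr hv)] at h1
    linarith
  have hpos : 0 < ‖S y‖ := by
    have := hbound w
    have h2 := norm_pos_iff.mpr hw
    by_contra! h3
    nlinarith [norm_nonneg w, norm_nonneg (S y)]
  set l := ‖S y‖ with hl
  refine ⟨l, y, l⁻¹ • S y, hpos, hy1, ?_, ?_, ?_, hbound⟩
  · rw [norm_smul, norm_inv, norm_norm, ← hl, inv_mul_cancel₀ hpos.ne']
  · rw [smul_inv_smul₀ hpos.ne']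
  · have hSS : S (S y) = -(l ^ 2 • y) := by
      rw [← sub_eq_zero, sub_neg_eq_add, ← norm_eq_zero]
      have h1 : ‖S (S y)‖ ≤ l ^ 2 := (hbound _).trans_eq (by rw [← hl, sq])
      have h2 : ⟪S (S y), y⟫ = -l ^ 2 := by
        have := hS (S y) y
        rw [real_inner_self_eq_norm_sq, ← hl] at this
        linarith
      have h3 := norm_add_sq_real (S (S y)) (l ^ 2 • y)
      rw [inner_smul_right, h2, norm_smul, hy1, Real.norm_of_nonneg (by positivity)] at h3
      have h4 : ‖S (S y)‖ ^ 2 ≤ (l ^ 2) ^ 2 := by gcongr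
      have : ‖S (S y) + l ^ 2 • y‖ ^ 2 ≤ 0 := by nlinarith
      exact pow_eq_zero_iff two_ne_zero |>.mp (le_antisymm this (sq_nonneg _))
    rw [map_smul, hSS, smul_neg, smul_smul, sq, inv_mul_cancel_left₀ hpos.ne']

variable {ι : Type*} [Fintype ι] [DecidableEq ι]

omit [FiniteDimensional ℝ 𝔤] in
/-- The squared distance from `A y` to the span of a coordinate block containing the unit
vector `y` is at most the squared size of the off-diagonal block of `A`. -/
theorem norm_sub_sq_le_sum_offDiagonal (b : OrthonormalBasis ι ℝ 𝔤) (s : Finset ι)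
    (A : 𝔤 →ₗ[ℝ] 𝔤) {y p : 𝔤} (hy1 : ‖y‖ = 1) (hy : ∀ k ∉ s, ⟪y, b k⟫ = 0)
    (hps : ∀ i ∈ s, ⟪A y - p, b i⟫ = 0) (hp : ∀ k ∉ s, ⟪p, b k⟫ = 0) :
    ‖A y - p‖ ^ 2 ≤ ∑ i ∈ s, ∑ k ∈ sᶜ, ⟪A (b i), b k⟫ ^ 2 := by
  have hsum : ∑ i ∈ s, ⟪y, b i⟫ ^ 2 = 1 := by
    have h := b.sum_sq_norm_inner_left y
    simp only [Real.norm_eq_abs, sq_abs, hy1, one_pow] at h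
    rw [← h]
    exact Finset.sum_subset (Finset.subset_univ s) fun k _ hk => by simp [hy k hk]
  have hexp : ∑ i ∈ s, ⟪y, b i⟫ • b i = y := by
    conv_rhs => rw [← b.sum_repr' y]
    simp_rw [fun k => real_inner_comm y (b k)]
    exact Finset.sum_subset (Finset.subset_univ s) fun k _ hk => by
      rw [hy k hk, zero_smul]
  rw [← b.sum_sq_norm_inner_left, Finset.sum_comm, ← Finset.sum_add_sum_compl s]
  simp only [Real.norm_eq_abs, sq_abs]
  rw [Finset.sum_eq_zero fun i hi => by rw [hps i hi, zero_pow two_ne_zero], zero_add]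
  refine Finset.sum_le_sum fun k hk => ?_
  rw [inner_sub_left, hp k (Finset.mem_compl.mp hk), sub_zero]
  conv_lhs => rw [← hexp]
  rw [map_sum, sum_inner]
  simp_rw [map_smul, inner_smul_left]
  refine (Finset.sum_mul_sq_le_sq_mul_sq s _ _).trans_eq ?_
  simp [hsum]

/-- A nonzero diagonal block of a skew operator is, on a suitable plane, a scaled rotation whose
scale controls the block and whose defect is controlled by the off-diagonal block. -/
theorem exists_approx_rotation_plane_of_skew (b : OrthonormalBasis ι ℝ 𝔤) (s : Finset ι)
    (A : 𝔤 →ₗ[ℝ] 𝔤) (hA : ∀ x y, ⟪A x, y⟫ + ⟪x, A y⟫ = 0)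
    (h0 : ∑ i ∈ s, ∑ j ∈ s, ⟪A (b i), b j⟫ ^ 2 ≠ 0) :
    ∃ (l : ℝ) (y z : 𝔤), 0 < l ∧ ‖y‖ = 1 ∧ ‖z‖ = 1 ∧
      (∀ k ∉ s, ⟪y, b k⟫ = 0) ∧ (∀ k ∉ s, ⟪z, b k⟫ = 0) ∧
      ∑ i ∈ s, ∑ j ∈ s, ⟪A (b i), b j⟫ ^ 2 ≤ (s.card : ℝ) ^ 2 * l ^ 2 ∧
      ‖A y - l • z‖ ^ 2 ≤ ∑ i ∈ s, ∑ k ∈ sᶜ, ⟪A (b i), b k⟫ ^ 2 ∧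
      ‖A z + l • y‖ ^ 2 ≤ ∑ i ∈ s, ∑ k ∈ sᶜ, ⟪A (b i), b k⟫ ^ 2 := by
  set V : Submodule ℝ 𝔤 := Submodule.span ℝ (b '' s) with hV
  have hbV : ∀ i ∈ s, b i ∈ V := fun i hi => Submodule.subset_span ⟨i, hi, rfl⟩
  have hVb : ∀ x ∈ V, ∀ k ∉ s, ⟪x, b k⟫ = 0 := by
    intro x hx k hk
    induction hx using Submodule.span_induction with
    | mem x hx =>
      obtain ⟨i, hi, rfl⟩ := hx
      exact b.inner_eq_zero fun h => hk (h ▸ hi)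
    | zero => exact inner_zero_left _
    | add x y _ _ hx hy => rw [inner_add_left, hx, hy, add_zero]
    | smul a x _ hx => rw [inner_smul_left, hx, mul_zero]
  set P : 𝔤 →ₗ[ℝ] 𝔤 := V.starProjection.toLinearMap with hP
  have hPsymm : ∀ x y, ⟪P x, y⟫ = ⟪x, P y⟫ := V.inner_starProjection_left_eq_right
  have hPV : ∀ x, P x ∈ V := fun x => V.starProjection_apply_mem x
  have hPid : ∀ x ∈ V, P x = x := fun x hx => Submodule.starProjection_eq_self_iff.mpr hx
  set S : 𝔤 →ₗ[ℝ] 𝔤 := P ∘ₗ A ∘ₗ P with hS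
  have hSV : ∀ x, S x ∈ V := fun x => hPV _
  have hSA : ∀ x ∈ V, ∀ i ∈ s, ⟪S x, b i⟫ = ⟪A x, b i⟫ := by
    intro x hx i hi
    simp only [hS, LinearMap.comp_apply]
    rw [hPsymm, hPid _ (hbV i hi), hPid _ hx]
  have hskew : ∀ x y, ⟪S x, y⟫ + ⟪x, S y⟫ = 0 := by
    intro x y
    simp only [hS, LinearMap.comp_apply]
    rw [hPsymm, ← hPsymm x]
    exact hA _ _
  have hS0 : S ≠ 0 := by
    intro h
    refine h0 (Finset.sum_eq_zero fun i hi => Finset.sum_eq_zero fun j hj => ?_)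
    rw [← hSA _ (hbV i hi) j hj, h]
    simp
  obtain ⟨l, y, z, hl, hy1, hz1, hSy, hSz, hbound⟩ := exists_rotation_plane_of_skew S hskew hS0
  have hzV : z ∈ V := by
    have := V.smul_mem l⁻¹ (hSV y)
    rwa [hSy, inv_smul_smul₀ hl.ne'] at this
  have hyV : y ∈ V := by
    have := V.smul_mem (-l⁻¹) (hSV z)
    rwa [hSz, neg_smul, smul_neg, neg_neg, inv_smul_smul₀ hl.ne'] at this
  refine ⟨l, y, z, hl, hy1, hz1, hVb y hyV, hVb z hzV, ?_, ?_, ?_⟩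
  · calc ∑ i ∈ s, ∑ j ∈ s, ⟪A (b i), b j⟫ ^ 2 ≤ ∑ _i ∈ s, ∑ _j ∈ s, l ^ 2 := by
          refine Finset.sum_le_sum fun i hi => Finset.sum_le_sum fun j hj => ?_
          rw [← hSA _ (hbV i hi) j hj, ← sq_abs]
          have := (abs_real_inner_le_norm (S (b i)) (b j)).trans
            (mul_le_mul_of_nonneg_right (hbound (b i)) (norm_nonneg _))
          rw [b.norm_eq_one, b.norm_eq_one, mul_one, mul_one] at this
          gcongr
      _ = _ := by simp; ring
  · refine norm_sub_sq_le_sum_offDiagonal b s A hy1 (hVb y hyV) (fun i hi => ?_)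
      (hVb _ (V.smul_mem _ hzV))
    rw [inner_sub_left, ← hSA y hyV i hi, hSy, sub_self]
  · rw [← sub_neg_eq_add]
    refine norm_sub_sq_le_sum_offDiagonal b s A hz1 (hVb z hzV) (fun i hi => ?_)
      (hVb _ (V.neg_mem (V.smul_mem _ hyV)))
    rw [inner_sub_left, ← hSA z hzV i hi, hSz, sub_self]

end Skew

section Adjoint

variable {ι : Type*} [Fintype ι] [DecidableEq ι]

/-- The complexified matrix of `L x` in an orthonormal basis. -/
noncomputable def adMatrix (L : 𝔤 →ₗ[ℝ] 𝔤 →ₗ[ℝ] 𝔤) (b : OrthonormalBasis ι ℝ 𝔤) :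
    𝔤 →ₗ[ℝ] Matrix ι ι ℂ :=
  Complex.ofRealCLM.toLinearMap.mapMatrix ∘ₗ
    (LinearMap.toMatrix b.toBasis b.toBasis).toLinearMap ∘ₗ L

omit [FiniteDimensional ℝ 𝔤] in
theorem adMatrix_apply (L : 𝔤 →ₗ[ℝ] 𝔤 →ₗ[ℝ] 𝔤) (b : OrthonormalBasis ι ℝ 𝔤) (x : 𝔤) :
    adMatrix L b x = (LinearMap.toMatrix b.toBasis b.toBasis (L x)).map Complex.ofRealHom :=
  rfl

omit [FiniteDimensional ℝ 𝔤] in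
theorem adMatrix_apply_apply (L : 𝔤 →ₗ[ℝ] 𝔤 →ₗ[ℝ] 𝔤) (b : OrthonormalBasis ι ℝ 𝔤) (x : 𝔤)
    (i j : ι) : adMatrix L b x i j = ((⟪b i, L x (b j)⟫ : ℝ) : ℂ) := by
  simp [adMatrix_apply, LinearMap.toMatrix_apply, b.repr_apply_apply]

omit [FiniteDimensional ℝ 𝔤] in
theorem adMatrix_bracket (L : 𝔤 →ₗ[ℝ] 𝔤 →ₗ[ℝ] 𝔤) (b : OrthonormalBasis ι ℝ 𝔤)
    (halt : ∀ x : 𝔤, L x x = 0)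
    (hjac : ∀ x y z : 𝔤, L x (L y z) + L y (L z x) + L z (L x y) = 0) (x y : 𝔤) :
    adMatrix L b (L x y) = adMatrix L b x * adMatrix L b y - adMatrix L b y * adMatrix L b x := by
  have hanti : ∀ u v, L u v = -L v u := by
    intro u v
    have := halt (u + v)
    simp only [map_add, LinearMap.add_apply, halt, zero_add, add_zero] at this
    exact eq_neg_of_add_eq_zero_right this
  have h : L (L x y) = L x * L y - L y * L x := by
    ext w
    have h1 := hjac x y w
    rw [hanti w x, map_neg, hanti w] at h1
    simp only [LinearMap.sub_apply, Module.End.mul_apply]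
    rw [← sub_eq_zero, ← neg_eq_zero, ← h1]
    abel
  simp only [adMatrix_apply]
  rw [h, map_sub, LinearMap.toMatrix_mul, LinearMap.toMatrix_mul,
    Matrix.map_sub _ (map_sub Complex.ofRealHom), Matrix.map_mul, Matrix.map_mul]

omit [FiniteDimensional ℝ 𝔤] in
theorem adMatrix_conjTranspose (L : 𝔤 →ₗ[ℝ] 𝔤 →ₗ[ℝ] 𝔤) (b : OrthonormalBasis ι ℝ 𝔤)
    (had : ∀ x y z : 𝔤, ⟪L x y, z⟫ + ⟪y, L x z⟫ = 0) (x : 𝔤) :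
    (adMatrix L b x).conjTranspose = -adMatrix L b x := by
  ext i j
  simp only [Matrix.conjTranspose_apply, Matrix.neg_apply, adMatrix_apply_apply]
  rw [RCLike.star_def, Complex.conj_ofReal, ← Complex.ofReal_neg, real_inner_comm,
    eq_neg_of_add_eq_zero_left (had x (b i) (b j))]

/-- If `y n`, `z n` span an asymptotic rotation plane of `L (d n)`, where `d n` may be unbounded,
and their limits commute, then the limit of `z n` vanishes. -/
theorem eq_zero_of_tendsto_rotation_plane (L : 𝔤 →ₗ[ℝ] 𝔤 →ₗ[ℝ] 𝔤) (halt : ∀ x : 𝔤, L x x = 0)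
    (hjac : ∀ x y z : 𝔤, L x (L y z) + L y (L z x) + L z (L x y) = 0)
    (had : ∀ x y z : 𝔤, ⟪L x y, z⟫ + ⟪y, L x z⟫ = 0)
    {d y z : ℕ → 𝔤} {y₀ z₀ : 𝔤} (hy : Tendsto y atTop (nhds y₀)) (hz : Tendsto z atTop (nhds z₀))
    (hdy : Tendsto (fun n => L (d n) (y n) - z n) atTop (nhds 0))
    (hdz : Tendsto (fun n => L (d n) (z n) + y n) atTop (nhds 0))
    (hcomm : L y₀ z₀ = 0) : z₀ = 0 := by
  set b := stdOrthonormalBasis ℝ 𝔤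
  set M := adMatrix L b with hM
  have hMc : Continuous M := M.continuous_of_finiteDimensional
  have hMt : ∀ {u : ℕ → 𝔤} {u₀ : 𝔤}, Tendsto u atTop (nhds u₀) →
      Tendsto (fun n => M (u n)) atTop (nhds (M u₀)) := fun h => (hMc.tendsto _).comp h
  have hbr := adMatrix_bracket L b halt hjac
  rw [← hM] at hbr
  have hnil : IsNilpotent (M y₀ + Complex.I • M z₀) := by
    refine Matrix.isNilpotent_of_tendsto_commutator (D := fun n => M (d n))
      (T := fun n => M (y n) + Complex.I • M (z n))
      (R := fun n => M (L (d n) (y n) - z n) + Complex.I • M (L (d n) (z n) + y n)) ?_ ?_ ?_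
    · intro n
      simp only [map_sub, map_add, hbr, mul_add, add_mul, smul_add, smul_sub, mul_smul_comm,
        smul_mul_assoc, smul_smul, neg_mul, Complex.I_mul_I, neg_smul, one_smul, neg_neg]
      abel
    · simpa using (hMt hdy).add ((hMt hdz).const_smul Complex.I)
    · exact (hMt hy).add ((hMt hz).const_smul Complex.I)
  have hMcomm : M y₀ * M z₀ = M z₀ * M y₀ := by
    rw [← sub_eq_zero, ← hbr, hcomm, map_zero]
  have hT0 : M y₀ + Complex.I • M z₀ = 0 := by
    refine Matrix.eq_zero_of_isNilpotent_of_commute_conjTranspose hnil ?_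
    rw [Matrix.conjTranspose_add, Matrix.conjTranspose_smul, hM, adMatrix_conjTranspose L b had,
      adMatrix_conjTranspose L b had, ← hM, commute_iff_eq]
    simp only [mul_add, add_mul, mul_smul_comm, smul_mul_assoc, neg_mul, mul_neg, smul_add, smul_neg,
      hMcomm, RCLike.star_def, Complex.conj_I, neg_smul]
    abel
  have hLz : ∀ w, L z₀ w = 0 := by
    have h1 : L z₀ = 0 := by
      refine b.toBasis.ext fun j => b.toBasis.ext_elem fun i => ?_
      have h2 := congrArg Complex.im (congrFun (congrFun hT0 i) j)
      simpa [hM, adMatrix_apply_apply, b.repr_apply_apply] using h2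
    simp [h1]
  have hLz' : ∀ w, L w z₀ = 0 := by
    intro w
    have := halt (w + z₀)
    simpa [halt, hLz] using this
  have hlim : Tendsto (fun n => ⟪L (d n) (y n) - z n, z₀⟫) atTop (nhds (-⟪z₀, z₀⟫)) := by
    have h1 : ∀ n, ⟪L (d n) (y n) - z n, z₀⟫ = -⟪z n, z₀⟫ := by
      intro n
      have := had (d n) (y n) z₀
      rw [hLz', inner_zero_right, add_zero] at this
      rw [inner_sub_left, this, zero_sub]
    simp_rw [h1]
    exact (hz.inner tendsto_const_nhds).neg
  have hlim' : Tendsto (fun n => ⟪L (d n) (y n) - z n, z₀⟫) atTop (nhds 0) := by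
    simpa using hdy.inner (tendsto_const_nhds (x := z₀))
  simpa using tendsto_nhds_unique hlim hlim'

end Adjoint

omit [FiniteDimensional ℝ 𝔤] in
/-- Limits of vectors in moving coordinate subspaces lie in the limiting coordinate subspace. -/
theorem mem_span_of_tendsto_orthonormalBasis {ι : Type*} [Fintype ι] {s : Finset ι}
    {b : ℕ → OrthonormalBasis ι ℝ 𝔤} {e : ι → 𝔤}
    (hb : ∀ i, Tendsto (fun n => b n i) atTop (nhds (e i))) {y : ℕ → 𝔤} {y₀ : 𝔤}
    (hy : Tendsto y atTop (nhds y₀)) (hys : ∀ n, ∀ k ∉ s, ⟪y n, b n k⟫ = 0) :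
    y₀ ∈ Submodule.span ℝ (e '' s) := by
  have h1 : ∀ n, ∑ i ∈ s, ⟪b n i, y n⟫ • b n i = y n := by
    intro n
    conv_rhs => rw [← (b n).sum_repr' (y n)]
    exact Finset.sum_subset (Finset.subset_univ s) fun k _ hk => by
      rw [real_inner_comm, hys n k hk, zero_smul]
  have h2 : Tendsto y atTop (nhds (∑ i ∈ s, ⟪e i, y₀⟫ • e i)) := by
    refine Tendsto.congr h1 (tendsto_finsetSum s fun i _ => ?_)
    exact ((hb i).inner hy).smul (hb i)
  rw [tendsto_nhds_unique hy h2]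
  exact Submodule.sum_mem _ fun i hi => Submodule.smul_mem _ _ (Submodule.subset_span ⟨i, hi, rfl⟩)

theorem norm_inv_smul_sq_le {E : Type*} [NormedAddCommGroup E] [NormedSpace ℝ E] {l c t D : ℝ}
    {v : E} (hl : 0 < l) (ht : 0 < t)
    (hD : t * D ≤ c * l ^ 2) (hv : ‖v‖ ^ 2 ≤ D) : ‖l⁻¹ • v‖ ^ 2 ≤ c / t := by
  rw [norm_smul, mul_pow, norm_inv, Real.norm_of_nonneg hl.le, inv_pow,
    inv_mul_le_iff₀ (by positivity), ← mul_div_assoc, le_div_iff₀ ht]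
  nlinarith

theorem tendsto_zero_of_norm_sq_le_div {E : Type*} [NormedAddCommGroup E] {v : ℕ → E} {c : ℝ}
    (h : ∀ m, ‖v m‖ ^ 2 ≤ c / ((m : ℝ) + 1)) : Tendsto v atTop (nhds 0) := by
  have h1 : Tendsto (fun m => ‖v m‖ ^ 2) atTop (nhds 0) := by
    refine squeeze_zero (fun m => sq_nonneg _) h ?_
    have := (tendsto_one_div_add_atTop_nhds_zero_nat (𝕜 := ℝ)).const_mul c
    simpa [div_eq_mul_inv] using this
  rw [tendsto_zero_iff_norm_tendsto_zero]
  simpa using h1.sqrt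

/-- (Böhm's fundamental estimate.)  Let `𝔞 ⊆ 𝔤` be an abelian Lie
subalgebra, `(e_1, …, e_N)` a `Q`-orthonormal basis of `𝔤` with
`𝔞 = span(e_1, …, e_{q+1})`, and `(e_1⁽ⁿ⁾, …, e_N⁽ⁿ⁾)` a sequence of `Q`-orthonormal
bases with `e_i⁽ⁿ⁾ → e_i`.  Then there exist `n₀` and `C > 0` such that for all `n ≥ n₀`,
`Σ_{i,j ≤ q+1} Q(⁅e_1⁽ⁿ⁾, e_i⁽ⁿ⁾⁆, e_j⁽ⁿ⁾)² ≤ C Σ_{i ≤ q+1 < k} Q(⁅e_1⁽ⁿ⁾, e_i⁽ⁿ⁾⁆, e_k⁽ⁿ⁾)²`.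
(Indices are zero-based: the first `q+1` basis vectors are those with `(i : ℕ) ≤ q`, and
`e_1` is the basis vector of index `0`.) -/
theorem boehm_crucial_estimate {N : ℕ}
    -- 𝔤 is a real Lie algebra with bracket L …
    (L : 𝔤 →ₗ[ℝ] 𝔤 →ₗ[ℝ] 𝔤)
    (halt : ∀ x : 𝔤, L x x = 0)
    (hjac : ∀ x y z : 𝔤, L x (L y z) + L y (L z x) + L z (L x y) = 0)
    -- … whose inner product Q is ad-invariant
    (had : ∀ x y z : 𝔤, ⟪L x y, z⟫ + ⟪y, L x z⟫ = 0)
    (q : ℕ) (hqN : q + 1 ≤ N)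
    -- (e_1, …, e_N) is a Q-orthonormal basis of 𝔤
    (e : Fin N → 𝔤) (he_on : ∀ i j, ⟪e i, e j⟫ = if i = j then 1 else 0)
    (he_span : Submodule.span ℝ (Set.range e) = ⊤)
    -- 𝔞 = span(e_1, …, e_{q+1}) is an abelian Lie subalgebra
    (𝔞 : Submodule ℝ 𝔤)
    (h𝔞 : 𝔞 = Submodule.span ℝ (e '' {i : Fin N | (i : ℕ) ≤ q}))
    (h𝔞ab : ∀ x ∈ 𝔞, ∀ y ∈ 𝔞, L x y = 0)
    -- a sequence of Q-orthonormal bases converging to (e_i)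
    (en : ℕ → Fin N → 𝔤)
    (hen_on : ∀ n i j, ⟪en n i, en n j⟫ = if i = j then 1 else 0)
    (hen_span : ∀ n, Submodule.span ℝ (Set.range (en n)) = ⊤)
    (hen_conv : ∀ i, Tendsto (fun n => en n i) atTop (nhds (e i))) :
    ∃ n₀ : ℕ, ∃ C : ℝ, 0 < C ∧ ∀ n ≥ n₀,
      ∑ i ∈ Finset.univ.filter (fun i : Fin N => (i : ℕ) ≤ q),
        ∑ j ∈ Finset.univ.filter (fun j : Fin N => (j : ℕ) ≤ q),
          ⟪L (en n ⟨0, by omega⟩) (en n i), en n j⟫ ^ 2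
      ≤ C * ∑ i ∈ Finset.univ.filter (fun i : Fin N => (i : ℕ) ≤ q),
            ∑ k ∈ Finset.univ.filter (fun k : Fin N => q < (k : ℕ)),
              ⟪L (en n ⟨0, by omega⟩) (en n i), en n k⟫ ^ 2 := by
  set s : Finset (Fin N) := Finset.univ.filter (fun i : Fin N => (i : ℕ) ≤ q) with hs
  have hsc : Finset.univ.filter (fun k : Fin N => q < (k : ℕ)) = sᶜ := by
    ext k
    simp [hs]
  have hs_coe : (s : Set (Fin N)) = {i : Fin N | (i : ℕ) ≤ q} := by
    ext k
    simp [hs]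
  rw [hsc]
  set o : Fin N := ⟨0, by omega⟩
  obtain ⟨b, hb⟩ : ∃ b : ℕ → OrthonormalBasis (Fin N) ℝ 𝔤, ∀ n i, b n i = en n i :=
    ⟨fun n => OrthonormalBasis.mk (orthonormal_iff_ite.mpr (hen_on n)) (hen_span n).ge,
      fun n i => by simp⟩
  simp_rw [← hb] at hen_conv ⊢
  by_contra! hcon
  choose φ hφ hlt using fun m : ℕ => hcon m ((m : ℝ) + 1) (by positivity)
  have hφt : Tendsto φ atTop atTop := tendsto_atTop_mono hφ tendsto_id
  have hoff : ∀ m, 0 ≤ ∑ i ∈ s, ∑ k ∈ sᶜ, ⟪L (b (φ m) o) (b (φ m) i), b (φ m) k⟫ ^ 2 :=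
    fun m => Finset.sum_nonneg fun i _ => Finset.sum_nonneg fun k _ => sq_nonneg _
  choose l y z hl hy1 hz1 hys hzs hdiag hAy hAz using fun m =>
    exists_approx_rotation_plane_of_skew (b (φ m)) s (L (b (φ m) o)) (had _)
      (lt_of_le_of_lt (mul_nonneg (by positivity) (hoff m)) (hlt m)).ne'
  have hres : ∀ {v : ℕ → 𝔤}, (∀ m, ‖v m‖ ^ 2 ≤
      ∑ i ∈ s, ∑ k ∈ sᶜ, ⟪L (b (φ m) o) (b (φ m) i), b (φ m) k⟫ ^ 2) →
      Tendsto (fun m => (l m)⁻¹ • v m) atTop (nhds 0) := fun h =>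
    tendsto_zero_of_norm_sq_le_div fun m => norm_inv_smul_sq_le (hl m) (by positivity)
      ((hlt m).le.trans (hdiag m)) (h m)
  have hdy : Tendsto (fun m => L ((l m)⁻¹ • b (φ m) o) (y m) - z m) atTop (nhds 0) := by
    refine (hres hAy).congr fun m => ?_
    rw [smul_sub, inv_smul_smul₀ (hl m).ne', map_smul, LinearMap.smul_apply]
  have hdz : Tendsto (fun m => L ((l m)⁻¹ • b (φ m) o) (z m) + y m) atTop (nhds 0) := by
    refine (hres hAz).congr fun m => ?_
    rw [smul_add, inv_smul_smul₀ (hl m).ne', map_smul, LinearMap.smul_apply]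
  obtain ⟨⟨y₀, z₀⟩, -, ψ, hψ, hlim⟩ := tendsto_subseq_of_bounded
    (x := fun m => (y m, z m)) (Metric.isBounded_closedBall (x := (0 : 𝔤 × 𝔤)) (r := 1))
    (fun m => by simp [Prod.norm_def, hy1, hz1])
  have hψt := hψ.tendsto_atTop
  have hy : Tendsto (fun m => y (ψ m)) atTop (nhds y₀) := (continuous_fst.tendsto _).comp hlim
  have hz : Tendsto (fun m => z (ψ m)) atTop (nhds z₀) := (continuous_snd.tendsto _).comp hlim
  have hbt : ∀ i, Tendsto (fun m => b (φ (ψ m)) i) atTop (nhds (e i)) :=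
    fun i => (hen_conv i).comp (hφt.comp hψt)
  have hmem : ∀ {v : ℕ → 𝔤} {v₀ : 𝔤}, Tendsto (fun m => v (ψ m)) atTop (nhds v₀) →
      (∀ m, ∀ k ∉ s, ⟪v m, b (φ m) k⟫ = 0) → v₀ ∈ 𝔞 := by
    intro v v₀ hv hvs
    rw [h𝔞, ← hs_coe]
    exact mem_span_of_tendsto_orthonormalBasis hbt hv fun m => hvs (ψ m)
  have hz0 : z₀ = 0 := eq_zero_of_tendsto_rotation_plane L halt hjac had hy hz (hdy.comp hψt)
    (hdz.comp hψt) (h𝔞ab _ (hmem hy hys) _ (hmem hz hzs))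
  have hnorm := hz.norm
  simp only [hz1, hz0, norm_zero] at hnorm
  exact one_ne_zero (tendsto_nhds_unique tendsto_const_nhds hnorm)
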